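/- arXiv:1504.06782 — 4 statements merged into one kernel-verified Lean document; each statement's English description precedes it below -/
import Mathlib

section
/- Let N ≥ 1 and r be natural numbers, let p, w : Fin N → ℝ, let c, c', α : Fin N → Fin N → ℝ, let β : Fin r → ℝ with β k ≥ 0 for all k, and let B : Fin r → Fin N → Fin N → ℝ. Assume the Lagrangian decomposition c n m = c' n m + α n m + α m n + ∑_{k : Fin r} β k * B k n m holds for all n ≠ m, and that c' n m ≥ 0 for all n ≠ m. Then for every feasible 0-1 matrix δ that additionally satisfies the cycle elimination constraints ∑_{n} ∑_{m} B k n m * δ n m ≥ 1 for every k : Fin r, one has ∑_{n ≠ m} c n m * δ n m + ∑_{m} p m * w m ≥ ∑_{n ≠ m} α n m + ∑_{k : Fin r} β k + ∑_{m} p m * w m. (This is Theorem 1: LB^{(r)} = ∑_{n ≠ m} α n m + ∑_{k} β k + ∑_{m} p m w m is a lower bound for the sum of weighted completion times.) -/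
/-- A 0-1 matrix `δ` is feasible if `δ n m ∈ {0,1}`, `δ n n = 0`,
`δ n m + δ m n = 1` for `n ≠ m`, and `δ n m + δ m k + δ k n ≥ 1`
for pairwise distinct `n, m, k`. -/
def Feasible {N : ℕ} (δ : Fin N → Fin N → ℝ) : Prop :=
  (∀ n m, δ n m = 0 ∨ δ n m = 1) ∧
  (∀ n, δ n n = 0) ∧
  (∀ n m, n ≠ m → δ n m + δ m n = 1) ∧
  (∀ n m k, n ≠ m → n ≠ k → m ≠ k → δ n m + δ m k + δ k n ≥ 1)

/-- Theorem 1: `LB^{(r)} = ∑_{n ≠ m} α n m + ∑_k β k + ∑_m p m w m` is a lower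
bound for the sum of weighted completion times of any feasible schedule that
satisfies the cycle elimination constraints. -/
theorem lagrangian_lower_bound
    (N r : ℕ) (hN : 1 ≤ N)
    (p w : Fin N → ℝ)
    (c c' α : Fin N → Fin N → ℝ)
    (β : Fin r → ℝ) (hβ : ∀ k, β k ≥ 0)
    (B : Fin r → Fin N → Fin N → ℝ)
    (hdec : ∀ n m : Fin N, n ≠ m →
      c n m = c' n m + α n m + α m n + ∑ k : Fin r, β k * B k n m)
    (hc' : ∀ n m : Fin N, n ≠ m → c' n m ≥ 0)
    (δ : Fin N → Fin N → ℝ) (hδ : Feasible δ)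
    (hcyc : ∀ k : Fin r, ∑ n : Fin N, ∑ m : Fin N, B k n m * δ n m ≥ 1) :
    ∑ n : Fin N, ∑ m ∈ Finset.univ.erase n, c n m * δ n m + ∑ m : Fin N, p m * w m ≥
      ∑ n : Fin N, ∑ m ∈ Finset.univ.erase n, α n m + ∑ k : Fin r, β k
        + ∑ m : Fin N, p m * w m := by
  obtain ⟨hbin, hdiag, hpair, -⟩ := hδ
  have hnonneg : ∀ n m, 0 ≤ δ n m := fun n m => by
    rcases hbin n m with h | h <;> simp [h]
  have hfull : ∀ n, ∑ m ∈ Finset.univ.erase n, c n m * δ n m = ∑ m, c n m * δ n m :=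
    fun n => Finset.sum_erase _ (by simp [hdiag])
  have hterm : ∀ n m, α n m * δ n m + α m n * δ n m + ∑ k, β k * (B k n m * δ n m)
      ≤ c n m * δ n m := by
    intro n m
    by_cases h : n = m
    · subst h
      simp [hdiag]
    · have hnn := mul_nonneg (hc' n m h) (hnonneg n m)
      simp only [← mul_assoc, ← Finset.sum_mul]
      rw [hdec n m h]
      linarith
  have hα : ∑ n, ∑ m, α n m * δ n m + ∑ n, ∑ m, α m n * δ n m
      = ∑ n, ∑ m ∈ Finset.univ.erase n, α n m := by
    rw [Finset.sum_comm (f := fun n m => α m n * δ n m), ← Finset.sum_add_distrib]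
    refine Finset.sum_congr rfl fun n _ => ?_
    rw [← Finset.sum_add_distrib, ← Finset.sum_erase (a := n) _ (by simp [hdiag])]
    refine Finset.sum_congr rfl fun m hm => ?_
    rw [← mul_add, hpair n m (Finset.ne_of_mem_erase hm).symm, mul_one]
  have hβB : ∑ k, β k ≤ ∑ n, ∑ m, ∑ k, β k * (B k n m * δ n m) := by
    calc ∑ k, β k ≤ ∑ k, β k * ∑ n, ∑ m, B k n m * δ n m :=
          Finset.sum_le_sum fun k _ => le_mul_of_one_le_right (hβ k) (hcyc k)
      _ = ∑ n, ∑ m, ∑ k, β k * (B k n m * δ n m) := by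
          simp only [Finset.mul_sum]
          rw [Finset.sum_comm]
          exact Finset.sum_congr rfl fun n _ => Finset.sum_comm
  have hsum := Finset.sum_le_sum fun n (_ : n ∈ Finset.univ) =>
    Finset.sum_le_sum fun m (_ : m ∈ Finset.univ) => hterm n m
  simp only [Finset.sum_add_distrib] at hsum
  simp only [hfull]
  linarith
end

section
/- Let N ≥ 1 and let c' : Fin N → Fin N → ℝ satisfy c' n m ≥ 0 for all n ≠ m. Then there exists a feasible 0-1 matrix δ with ∑_{n ≠ m} c' n m * δ n m = 0 if and only if the directed graph on Fin N with an edge from n to m whenever n ≠ m and c' n m > 0 contains no directed cycle, i.e., if and only if for every n : Fin N it is not the case that n is related to itself under the transitive closure of the relation R n m := (n ≠ m ∧ c' n m > 0). (This is Theorem 2: a zero-cost feasible ordering exists for the reduced cost matrix exactly when no additional cycle elimination constraint with a positive multiplier can be introduced.) -/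
/-- The relation "distinct with a zero entry" of a feasible matrix is transitive. -/
theorem Feasible.zero_trans {N : ℕ} {δ : Fin N → Fin N → ℝ} (hδ : Feasible δ) {a b c : Fin N}
    (hab : a ≠ b ∧ δ a b = 0) (hbc : b ≠ c ∧ δ b c = 0) : a ≠ c ∧ δ a c = 0 := by
  obtain ⟨h01, -, hsum, htri⟩ := hδ
  have hac : a ≠ c := by
    rintro rfl
    linarith [hsum a b hab.1, hab.2, hbc.2]
  refine ⟨hac, (h01 a c).resolve_right fun h => ?_⟩
  linarith [hsum a c hac, htri a b c hab.1 hac hbc.1, hab.2, hbc.2]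

/-- The strict part of a reversed linear order on `Fin N`, as a 0-1 matrix, is feasible. -/
theorem feasible_of_isLinearOrder {N : ℕ} (s : Fin N → Fin N → Prop) [IsLinearOrder (Fin N) s]
    [∀ n m, Decidable (n ≠ m ∧ s m n)] :
    Feasible fun n m => if n ≠ m ∧ s m n then (1 : ℝ) else 0 := by
  have anti : ∀ {a b}, s a b → s b a → a = b := antisymm_of s
  have tot : ∀ a b, s a b ∨ s b a := total_of s
  have tr : ∀ {a b c}, s a b → s b c → s a c := trans_of s
  refine ⟨fun n m => ?_, fun n => by simp, fun n m hnm => ?_, fun n m k hnm hnk hmk => ?_⟩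
  · dsimp only
    split_ifs <;> simp
  · by_cases h : s m n
    · have h' : ¬ s n m := fun h' => hnm (anti h' h)
      simp [h, h', hnm]
    · simp [h, (tot m n).resolve_left h, hnm.symm]
  · by_cases h₁ : s m n
    · simp only [ne_eq, hnm, not_false_eq_true, h₁, and_self, if_true]
      split_ifs <;> norm_num
    · by_cases h₂ : s k m
      · simp only [ne_eq, hmk, not_false_eq_true, h₂, and_self, if_true]
        split_ifs <;> norm_num
      · have h₃ : s n k := tr ((tot m n).resolve_left h₁) ((tot k m).resolve_left h₂)
        simp only [ne_eq, hnk.symm, not_false_eq_true, h₃, and_self, if_true]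
        split_ifs <;> norm_num

/-- The reflexive transitive closure of an acyclic relation extends to a linear order. -/
theorem exists_isLinearOrder_of_acyclic {α : Type*} {r : α → α → Prop}
    (h : ∀ a, ¬ Relation.TransGen r a a) :
    ∃ s : α → α → Prop, IsLinearOrder α s ∧ r ≤ s := by
  have : IsPartialOrder α (Relation.ReflTransGen r) :=
    { refl := fun _ => .refl
      trans := fun _ _ _ => .trans
      antisymm := fun a b hab hba => by
        rcases Relation.reflTransGen_iff_eq_or_transGen.1 hab with rfl | hab
        · rfl
        · exact (h a (hab.trans_left hba)).elim }
  obtain ⟨s, hs, hle⟩ := extend_partialOrder (Relation.ReflTransGen r)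
  exact ⟨s, hs, fun a b hab => hle a b (.single hab)⟩

/-- Theorem 2: a zero-cost feasible ordering exists for the reduced cost matrix
`c'` if and only if the directed graph with an edge from `n` to `m` whenever
`n ≠ m` and `c' n m > 0` contains no directed cycle. -/
theorem zero_cost_schedule_iff_acyclic
    (N : ℕ) (hN : 1 ≤ N)
    (c' : Fin N → Fin N → ℝ)
    (hc' : ∀ n m : Fin N, n ≠ m → c' n m ≥ 0) :
    (∃ δ : Fin N → Fin N → ℝ, Feasible δ ∧
        ∑ n : Fin N, ∑ m ∈ Finset.univ.erase n, c' n m * δ n m = 0) ↔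
      ∀ n : Fin N, ¬ Relation.TransGen (fun a b : Fin N => a ≠ b ∧ c' a b > 0) n n := by
  constructor
  · rintro ⟨δ, hδ, hcost⟩ n hn
    have hnonneg : ∀ a b, 0 ≤ δ a b := fun a b => by
      rcases hδ.1 a b with h | h <;> simp [h]
    have hterm : ∀ a, ∀ b ∈ Finset.univ.erase a, 0 ≤ c' a b * δ a b := fun a b hb =>
      mul_nonneg (hc' a b (Finset.ne_of_mem_erase hb).symm) (hnonneg a b)
    have hzero : ∀ a b, a ≠ b ∧ c' a b > 0 → a ≠ b ∧ δ a b = 0 := by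
      rintro a b ⟨hab, hpos⟩
      have hrow := (Finset.sum_eq_zero_iff_of_nonneg
        fun a _ => Finset.sum_nonneg (hterm a)).1 hcost a (Finset.mem_univ a)
      have hprod := (Finset.sum_eq_zero_iff_of_nonneg (hterm a)).1 hrow b (by simp [hab.symm])
      exact ⟨hab, (mul_eq_zero.1 hprod).resolve_left hpos.ne'⟩
    have key : ∀ b, Relation.TransGen (fun a b : Fin N => a ≠ b ∧ c' a b > 0) n b →
        n ≠ b ∧ δ n b = 0 := fun b hb => by
      induction hb with
      | single h => exact hzero _ _ h
      | tail _ h ih => exact hδ.zero_trans ih (hzero _ _ h)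
    exact (key n hn).1 rfl
  · intro h
    classical
    obtain ⟨s, hs, hle⟩ := exists_isLinearOrder_of_acyclic h
    refine ⟨_, feasible_of_isLinearOrder s, Finset.sum_eq_zero fun n _ =>
      Finset.sum_eq_zero fun m hm => ?_⟩
    have hnm : n ≠ m := (Finset.ne_of_mem_erase hm).symm
    rcases (hc' n m hnm).lt_or_eq with hpos | hzero
    · have hsmn : ¬ s m n := fun hsmn => hnm (antisymm_of s (hle n m ⟨hnm, hpos⟩) hsmn)
      simp [hsmn]
    · simp [← hzero]
end

section
/- Let N ≥ 1 and r be natural numbers, let p, w : Fin N → ℝ, let c, c', α : Fin N → Fin N → ℝ, let β : Fin r → ℝ, and let B : Fin r → Fin N → Fin N → ℝ, with the decomposition c n m = c' n m + α n m + α m n + ∑_{k : Fin r} β k * B k n m for all n ≠ m. Let δ be a feasible 0-1 matrix such that ∑_{n ≠ m} c' n m * δ n m = 0 and B k n n * δ n n = 0 for all k and n. Then the objective value of the schedule δ satisfies the exact identity ∑_{n ≠ m} c n m * δ n m + ∑_{m} p m * w m = (∑_{n ≠ m} α n m + ∑_{k} β k + ∑_{m} p m * w m) + ∑_{k} β k *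 (∑_{n} ∑_{m} B k n m * δ n m − 1), i.e., the schedule's sum of weighted completion times equals LB^{(r)} plus the total slack ∑_k β^{(k)}(∑_{n,m} b^{(k)}_{nm} δ_{nm} − 1). (This is the identity defining the upper bound UB^{(r)}.) -/
/-- An off-diagonal double sum is invariant under transposition. -/
theorem sum_sum_erase_comm {ι M : Type*} [Fintype ι] [DecidableEq ι] [AddCommMonoid M]
    (f : ι → ι → M) :
    ∑ n, ∑ m ∈ Finset.univ.erase n, f m n = ∑ n, ∑ m ∈ Finset.univ.erase n, f n m :=
  Finset.sum_comm' fun n m => by simp [ne_comm]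

/-- Symmetrized off-diagonal weights against a tournament matrix sum to the total weight. -/
theorem sum_sum_erase_add_transpose_mul {ι R : Type*} [Fintype ι] [DecidableEq ι]
    [CommSemiring R] (α δ : ι → ι → R) (hδ : ∀ n m, n ≠ m → δ n m + δ m n = 1) :
    ∑ n, ∑ m ∈ Finset.univ.erase n, (α n m + α m n) * δ n m
      = ∑ n, ∑ m ∈ Finset.univ.erase n, α n m := by
  simp only [add_mul, Finset.sum_add_distrib]
  rw [sum_sum_erase_comm fun n m => α n m * δ m n]
  simp only [← Finset.sum_add_distrib, ← mul_add]
  refine Finset.sum_congr rfl fun n _ => Finset.sum_congr rfl fun m hm => ?_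
  rw [hδ n m (Finset.ne_of_mem_erase hm).symm, mul_one]

/-- The identity defining the upper bound `UB^{(r)}`: if the feasible schedule
`δ` has zero reduced cost, its sum of weighted completion times equals the
Lagrangian lower bound `LB^{(r)}` plus the total slack
`∑ k β k * (∑ n ∑ m B k n m δ n m − 1)` of the cycle elimination constraints. -/
theorem upper_bound_identity
    (N r : ℕ) (hN : 1 ≤ N)
    (p w : Fin N → ℝ)
    (c c' α : Fin N → Fin N → ℝ)
    (β : Fin r → ℝ)
    (B : Fin r → Fin N → Fin N → ℝ)
    (hdec : ∀ n m : Fin N, n ≠ m →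
      c n m = c' n m + α n m + α m n + ∑ k : Fin r, β k * B k n m)
    (δ : Fin N → Fin N → ℝ) (hδ : Feasible δ)
    (hzero : ∑ n : Fin N, ∑ m ∈ Finset.univ.erase n, c' n m * δ n m = 0)
    (hBdiag : ∀ (k : Fin r) (n : Fin N), B k n n * δ n n = 0) :
    ∑ n : Fin N, ∑ m ∈ Finset.univ.erase n, c n m * δ n m + ∑ m : Fin N, p m * w m
      = (∑ n : Fin N, ∑ m ∈ Finset.univ.erase n, α n m + ∑ k : Fin r, β k
          + ∑ m : Fin N, p m * w m)
        + ∑ k : Fin r, β k * (∑ n : Fin N, ∑ m : Fin N, B k n m * δ n m - 1) := by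
  have hcost : ∑ n : Fin N, ∑ m ∈ Finset.univ.erase n, c n m * δ n m
      = ∑ n : Fin N, ∑ m ∈ Finset.univ.erase n, c' n m * δ n m
        + ∑ n : Fin N, ∑ m ∈ Finset.univ.erase n, (α n m + α m n) * δ n m
        + ∑ n : Fin N, ∑ m ∈ Finset.univ.erase n, (∑ k : Fin r, β k * B k n m) * δ n m := by
    simp only [← Finset.sum_add_distrib]
    refine Finset.sum_congr rfl fun n _ => Finset.sum_congr rfl fun m hm => ?_
    rw [hdec n m (Finset.ne_of_mem_erase hm).symm]
    ring
  have hcycle : ∑ n : Fin N, ∑ m ∈ Finset.univ.erase n, (∑ k : Fin r, β k * B k n m) * δ n m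
      = ∑ k : Fin r, β k * ∑ n : Fin N, ∑ m : Fin N, B k n m * δ n m := by
    have hdiag : ∀ (k : Fin r) (n : Fin N),
        ∑ m : Fin N, B k n m * δ n m = ∑ m ∈ Finset.univ.erase n, B k n m * δ n m :=
      fun k n => (Finset.sum_erase (f := fun m => B k n m * δ n m) _ (hBdiag k n)).symm
    simp only [hdiag, Finset.mul_sum, Finset.sum_mul, mul_assoc]
    rw [Finset.sum_comm]
    refine Finset.sum_congr rfl fun n _ => Finset.sum_comm
  rw [hcost, hzero, sum_sum_erase_add_transpose_mul α δ hδ.2.2.1, hcycle]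
  simp only [mul_sub, mul_one, Finset.sum_sub_distrib]
  ring
end

section
/- Let N ≥ 1 and r be natural numbers, let p, w : Fin N → ℝ with w m ≥ 0 for all m, and set c n m := p n * w m. Suppose there are α : Fin N → Fin N → ℝ, nonnegative multipliers β : Fin r → ℝ, a reduced cost matrix c' : Fin N → Fin N → ℝ with c' n m ≥ 0 for n ≠ m, and for each k : Fin r a cycle indicator B k, meaning there exist q_k ≥ 2 and an injective f_k : Fin q_k → Fin N such that B k n m = 1 if (n, m) = (f_k i, f_k (i+1)) for some i (indices modulo q_k) and B k n m = 0 otherwise, and that c n m = c' n m + α n m + α m n + ∑_{k} β k * B k n m for all n ≠ m. Then for every strict total order ≺ on Fin N, the sum of weighted completion times ∑_{m} w m * (p m + ∑_{n ≺ m} p n) is at least LB^{(r)} := ∑_{n ≠ m} α n m + ∑_{k} β k + ∑_{m} p m * w m. (This combines the reformulation (3), the validity of the cycle elimination constraints, and Theorem 1: every feasible transmission schedule has weighted completion time at least the Lagrangian lower bound.) -/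
open Classical

/-- Along a cycle of at least two distinct elements, a strict total order on a finite type
ascends at least once. -/
theorem exists_cycle_ascent {ι : Type*} [Finite ι] (lt : ι → ι → Prop)
    (hso : IsStrictTotalOrder ι lt) {q : ℕ} (hq : 2 ≤ q) (f : Fin q → ι)
    (hf : Function.Injective f) : ∃ i : Fin q, lt (f i) (f (i + ⟨1, hq⟩)) := by
  have hwf : WellFounded lt := Finite.wellFounded_of_trans_of_irrefl lt
  obtain ⟨_, ⟨i, rfl⟩, hmin⟩ := hwf.has_min (Set.range f) ⟨f ⟨0, by omega⟩, Set.mem_range_self _⟩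
  refine ⟨i, ?_⟩
  have hne : f i ≠ f (i + ⟨1, hq⟩) := by
    refine fun h => ?_
    have h' := congrArg Fin.val (hf h)
    have hi := i.isLt
    rw [Fin.val_add] at h'
    rcases Nat.lt_or_ge (i.val + 1) q with hlt | hge
    · rw [Nat.mod_eq_of_lt hlt] at h'
      omega
    · have hiq : i.val + 1 = q := by omega
      simp only [hiq, Nat.mod_self] at h'
      omega
  rcases trichotomous_of lt (f i) (f (i + ⟨1, hq⟩)) with h | h | h
  · exact h
  · exact absurd h hne
  · exact absurd h (hmin _ (Set.mem_range_self _))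

/-- The off-diagonal sum of a matrix, regrouped over the pairs ordered by a strict total order. -/
theorem sum_offDiag_eq_sum_lt {ι : Type*} [Fintype ι] [DecidableEq ι] (lt : ι → ι → Prop)
    (hso : IsStrictTotalOrder ι lt) (a : ι → ι → ℝ) :
    ∑ n, ∑ m ∈ Finset.univ.erase n, a n m
      = ∑ m, ∑ n ∈ Finset.univ.filter (fun n => lt n m), (a n m + a m n) := by
  have key : ∀ n m, (if m ≠ n then a n m else 0)
      = (if lt n m then a n m else 0) + (if lt m n then a n m else 0) := by
    intro n m
    rcases trichotomous_of lt n m with h | rfl | h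
    · have h1 : m ≠ n := fun e => irrefl_of lt m (by rwa [← e] at h)
      have h2 : ¬ lt m n := asymm_of lt h
      simp [h, h1, h2]
    · simp [irrefl_of lt n]
    · have h1 : m ≠ n := fun e => irrefl_of lt m (by rwa [← e] at h)
      have h2 : ¬ lt n m := asymm_of lt h
      simp [h, h1, h2]
  have herase : ∀ n : ι, Finset.univ.erase n = Finset.univ.filter (fun m => m ≠ n) := by
    intro n
    ext m
    simp
  simp only [herase, Finset.sum_filter, key, Finset.sum_add_distrib]
  rw [Finset.sum_comm]

/-- Cycle elimination constraint: the indicator of a directed cycle through distinct elements has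
total weight at least one on the pairs ordered by a strict total order. -/
theorem one_le_sum_lt_cycle_indicator {ι : Type*} [Fintype ι] [DecidableEq ι] (lt : ι → ι → Prop)
    (hso : IsStrictTotalOrder ι lt) {q : ℕ} (hq : 2 ≤ q) (f : Fin q → ι)
    (hf : Function.Injective f) :
    (1 : ℝ) ≤ ∑ m, ∑ n ∈ Finset.univ.filter (fun n => lt n m),
      if ∃ i : Fin q, n = f i ∧ m = f (i + ⟨1, hq⟩) then (1 : ℝ) else 0 := by
  obtain ⟨i, hi⟩ := exists_cycle_ascent lt hso hq f hf
  have hnn : ∀ n m : ι,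
      (0 : ℝ) ≤ if ∃ i : Fin q, n = f i ∧ m = f (i + ⟨1, hq⟩) then (1 : ℝ) else 0 := by
    intro n m
    split_ifs <;> norm_num
  calc (1 : ℝ) = if ∃ j : Fin q, f i = f j ∧ f (i + ⟨1, hq⟩) = f (j + ⟨1, hq⟩)
        then (1 : ℝ) else 0 := (if_pos ⟨i, rfl, rfl⟩).symm
    _ ≤ ∑ n ∈ Finset.univ.filter (fun n => lt n (f (i + ⟨1, hq⟩))),
        if ∃ j : Fin q, n = f j ∧ f (i + ⟨1, hq⟩) = f (j + ⟨1, hq⟩) then (1 : ℝ) else 0 :=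
      Finset.single_le_sum (f := fun n => if ∃ j : Fin q, n = f j ∧
        f (i + ⟨1, hq⟩) = f (j + ⟨1, hq⟩) then (1 : ℝ) else 0)
        (fun n _ => hnn n _) (by simpa using hi)
    _ ≤ _ := Finset.single_le_sum (f := fun m => ∑ n ∈ Finset.univ.filter (fun n => lt n m),
        if ∃ i : Fin q, n = f i ∧ m = f (i + ⟨1, hq⟩) then (1 : ℝ) else 0)
        (fun m _ => Finset.sum_nonneg fun n _ => hnn n m) (Finset.mem_univ _)

/-- Combination of the 0-1 reformulation, the validity of the cycle elimination
constraints, and Theorem 1: given a Lagrangian decomposition of the costs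
`c n m = p n * w m` with nonnegative multipliers `β k` for cycle elimination
constraints (the `B k` being indicators of directed cycles through distinct
PMUs) and a nonnegative reduced cost matrix `c'`, every feasible transmission
schedule (strict total order `≺`) has sum of weighted completion times
`∑ m w m * (p m + ∑_{n ≺ m} p n)` at least
`LB^{(r)} = ∑_{n ≠ m} α n m + ∑ k β k + ∑ m p m * w m`. -/
theorem every_schedule_at_least_lagrangian_bound
    (N r : ℕ) (hN : 1 ≤ N)
    (p w : Fin N → ℝ) (hw : ∀ m, w m ≥ 0)
    (α c' : Fin N → Fin N → ℝ)
    (β : Fin r → ℝ) (hβ : ∀ k, β k ≥ 0)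
    (hc' : ∀ n m : Fin N, n ≠ m → c' n m ≥ 0)
    (B : Fin r → Fin N → Fin N → ℝ)
    (hB : ∀ k : Fin r, ∃ q : ℕ, ∃ _hq : 2 ≤ q, ∃ f : Fin q → Fin N,
      Function.Injective f ∧
      ∀ n m : Fin N, B k n m =
        if ∃ i : Fin q, n = f i ∧ m = f (i + ⟨1, by omega⟩) then (1 : ℝ) else 0)
    (hdec : ∀ n m : Fin N, n ≠ m →
      p n * w m = c' n m + α n m + α m n + ∑ k : Fin r, β k * B k n m)
    (lt : Fin N → Fin N → Prop)
    (hso : IsStrictTotalOrder (Fin N) lt) :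
    ∑ m : Fin N, w m * (p m + ∑ n ∈ Finset.univ.filter (fun n => lt n m), p n)
      ≥ ∑ n : Fin N, ∑ m ∈ Finset.univ.erase n, α n m + ∑ k : Fin r, β k
        + ∑ m : Fin N, p m * w m := by
  have hcycle : ∀ k, 1 ≤ ∑ m, ∑ n ∈ Finset.univ.filter (fun n => lt n m), B k n m := by
    intro k
    obtain ⟨q, hq, f, hf, hBk⟩ := hB k
    simp only [hBk]
    exact one_le_sum_lt_cycle_indicator lt hso hq f hf
  have hβsum : ∑ k, β k
      ≤ ∑ m, ∑ n ∈ Finset.univ.filter (fun n => lt n m), ∑ k, β k * B k n m := by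
    calc ∑ k, β k
        ≤ ∑ k, β k * ∑ m, ∑ n ∈ Finset.univ.filter (fun n => lt n m), B k n m :=
          Finset.sum_le_sum fun k _ => le_mul_of_one_le_right (hβ k) (hcycle k)
      _ = ∑ m, ∑ n ∈ Finset.univ.filter (fun n => lt n m), ∑ k, β k * B k n m := by
          simp only [Finset.mul_sum]
          rw [Finset.sum_comm]
          exact Finset.sum_congr rfl fun m _ => Finset.sum_comm
  have hcost : ∑ m, ∑ n ∈ Finset.univ.filter (fun n => lt n m),
        ((α n m + α m n) + ∑ k, β k * B k n m)
      ≤ ∑ m, ∑ n ∈ Finset.univ.filter (fun n => lt n m), p n * w m := by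
    refine Finset.sum_le_sum fun m _ => Finset.sum_le_sum fun n hn => ?_
    have hlt : lt n m := (Finset.mem_filter.mp hn).2
    have hne : n ≠ m := fun e => irrefl_of lt m (by rwa [e] at hlt)
    linarith [hdec n m hne, hc' n m hne]
  have hobj : ∑ m, w m * (p m + ∑ n ∈ Finset.univ.filter (fun n => lt n m), p n)
      = ∑ m, p m * w m + ∑ m, ∑ n ∈ Finset.univ.filter (fun n => lt n m), p n * w m := by
    rw [← Finset.sum_add_distrib]
    refine Finset.sum_congr rfl fun m _ => ?_
    rw [← Finset.sum_mul]
    ring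
  simp only [Finset.sum_add_distrib] at hcost
  have hα := sum_offDiag_eq_sum_lt lt hso α
  simp only [Finset.sum_add_distrib] at hα
  rw [hobj]
  linarith
end
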